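/- If there is a collective strategy for the team that ensures, against every strategy of the opponent, that the play from the initial state never visits the set T with probability 1, then there is a deterministic memoryless collective strategy with the same property. -/

import Mathlib

/-!
Common framework: team concurrent stochastic reachability games.
-/

noncomputable section

/-- A concurrent game structure: finitely many players, finitely many states,
finitely many actions per player, available actions, and a probabilistic
transition function. -/
structure GameStructure where
  Player : Type
  [playerFin : Fintype Player]
  [playerDec : DecidableEq Player]
  State : Type
  [stateFin : Fintype State]
  [stateDec : DecidableEq State]
  Act : Player → Type
  [actFin : ∀ p, Fintype (Act p)]
  [actDec : ∀ p, DecidableEq (Act p)]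
  Av : (p : Player) → State → Finset (Act p)
  av_nonempty : ∀ p s, (Av p s).Nonempty
  trans : State → ((p : Player) → Act p) → State → ℝ
  trans_nonneg : ∀ s a t, 0 ≤ trans s a t
  trans_sum : ∀ s a, ∑ t, trans s a t = 1

attribute [instance] GameStructure.playerFin GameStructure.playerDec
  GameStructure.stateFin GameStructure.stateDec GameStructure.actFin GameStructure.actDec

/-- A (behavioural) strategy of player `p`: a distribution over available
actions, for every history `h` (the list of previously visited states)
and current state `s`. -/
structure Strategy (G : GameStructure) (p : G.Player) where
  toFun : List G.State → G.State → G.Act p → ℝ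
  nonneg : ∀ h s a, 0 ≤ toFun h s a
  support_av : ∀ h s a, a ∉ G.Av p s → toFun h s a = 0
  sum_one : ∀ h s, ∑ a, toFun h s a = 1

/-- A strategy is memoryless if it only depends on the current state. -/
def Strategy.Memoryless {G : GameStructure} {p : G.Player} (σ : Strategy G p) : Prop :=
  ∀ h h' s, σ.toFun h s = σ.toFun h' s

/-- A strategy is deterministic if it always plays a single action with probability 1. -/
def Strategy.Deterministic {G : GameStructure} {p : G.Player} (σ : Strategy G p) : Prop :=
  ∀ h s, ∃ a, σ.toFun h s a = 1

/-- A selector of player `p` at state `s`: a distribution over the available actions. -/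
structure Selector (G : GameStructure) (p : G.Player) (s : G.State) where
  toFun : G.Act p → ℝ
  nonneg : ∀ a, 0 ≤ toFun a
  support_av : ∀ a, a ∉ G.Av p s → toFun a = 0
  sum_one : ∑ a, toFun a = 1

/-- A game: a game structure together with a team, an absorbing target set,
and an initial state. -/
structure Game extends GameStructure where
  team : Finset Player
  target : Finset State
  init : State
  absorbing : ∀ t ∈ target, ∀ a, trans t a t = 1

namespace Game

variable (Gm : Game)

abbrev TeamPlayer := {p : Gm.Player // p ∈ Gm.team}
abbrev OppPlayer := {p : Gm.Player // p ∉ Gm.team}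

/-- A collective strategy: one strategy for each team player. -/
abbrev TeamStrategy := (p : Gm.TeamPlayer) → Strategy Gm.toGameStructure p.1
/-- An opponent strategy: one strategy for each player outside the team. -/
abbrev OppStrategy := (p : Gm.OppPlayer) → Strategy Gm.toGameStructure p.1

abbrev TeamAct := (p : Gm.TeamPlayer) → Gm.Act p.1
abbrev OppAct := (p : Gm.OppPlayer) → Gm.Act p.1

/-- A collective selector at state `s`. -/
abbrev TeamSelector (s : Gm.State) := (p : Gm.TeamPlayer) → Selector Gm.toGameStructure p.1 s

def MemorylessTeam (σ : Gm.TeamStrategy) : Prop := ∀ p, (σ p).Memoryless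
def DeterministicTeam (σ : Gm.TeamStrategy) : Prop := ∀ p, (σ p).Deterministic
def MemorylessOpp (τ : Gm.OppStrategy) : Prop := ∀ p, (τ p).Memoryless

/-- Combine a collective strategy and an opponent strategy into a full profile. -/
def combine (σ : Gm.TeamStrategy) (τ : Gm.OppStrategy) (p : Gm.Player) :
    Strategy Gm.toGameStructure p :=
  if h : p ∈ Gm.team then σ ⟨p, h⟩ else τ ⟨p, h⟩

/-- Combine a joint team action and a joint opponent action into a full action profile. -/
def combineAct (a : Gm.TeamAct) (b : Gm.OppAct) (p : Gm.Player) : Gm.Act p :=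
  if h : p ∈ Gm.team then a ⟨p, h⟩ else b ⟨p, h⟩

/-- A joint opponent action is available at `s`. -/
def OppAvailable (s : Gm.State) (b : Gm.OppAct) : Prop := ∀ p, b p ∈ Gm.Av p.1 s

/-- One-step transition probability, under a full strategy profile, from state `s`
with history `h`, to state `t` (players randomise independently). -/
def stepProb (π : (p : Gm.Player) → Strategy Gm.toGameStructure p)
    (h : List Gm.State) (s t : Gm.State) : ℝ :=
  ∑ a : (p : Gm.Player) → Gm.Act p, (∏ p, (π p).toFun h s (a p)) * Gm.trans s a t

/-- Probability of visiting the target within `n` steps, starting at state `s`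
with history `h`. -/
def reachWithin (π : (p : Gm.Player) → Strategy Gm.toGameStructure p) :
    ℕ → List Gm.State → Gm.State → ℝ
  | 0, _, s => if s ∈ Gm.target then 1 else 0
  | n + 1, h, s =>
      if s ∈ Gm.target then 1
      else ∑ t, Gm.stepProb π h s t * reachWithin π n (h ++ [s]) t

/-- Probability of eventually reaching the target set, starting from state `s`. -/
def reachProbFrom (π : (p : Gm.Player) → Strategy Gm.toGameStructure p) (s : Gm.State) : ℝ :=
  ⨆ n : ℕ, Gm.reachWithin π n [] s

/-- Probability of eventually reaching the target set from the initial state. -/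
def reachProb (π : (p : Gm.Player) → Strategy Gm.toGameStructure p) : ℝ :=
  Gm.reachProbFrom π Gm.init

/-- Probability of visiting the target set for the first time exactly at step `k`. -/
def firstHit (π : (p : Gm.Player) → Strategy Gm.toGameStructure p) :
    ℕ → List Gm.State → Gm.State → ℝ
  | 0, _, s => if s ∈ Gm.target then 1 else 0
  | k + 1, h, s =>
      if s ∈ Gm.target then 0
      else ∑ t, Gm.stepProb π h s t * firstHit π k (h ++ [s]) t

/-- Expected `lam`-discounted payoff from the initial state: the play pays `lam ^ k`
if it first visits the target at step `k`, and `0` if it never visits the target. -/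
def discounted (π : (p : Gm.Player) → Strategy Gm.toGameStructure p) (lam : ℝ) : ℝ :=
  ∑' k : ℕ, lam ^ k * Gm.firstHit π k [] Gm.init

/-- A play (an infinite sequence of states from the initial state) is compatible with
a strategy profile if each of its transitions occurs with positive probability. -/
def CompatiblePlay (π : (p : Gm.Player) → Strategy Gm.toGameStructure p)
    (play : ℕ → Gm.State) : Prop :=
  play 0 = Gm.init ∧
  ∀ n, 0 < Gm.stepProb π (List.ofFn fun i : Fin n => play i.1) (play n) (play (n + 1))

/-- Expected value of the valuation `v` at the successor of `s`, when the team plays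
according to the collective selector `ξ` and the opponent plays the joint action `b`. -/
def preTeamAct (v : Gm.State → ℝ) (s : Gm.State) (ξ : Gm.TeamSelector s) (b : Gm.OppAct) : ℝ :=
  ∑ a : Gm.TeamAct, (∏ p, (ξ p).toFun (a p)) * ∑ t, Gm.trans s (Gm.combineAct a b) t * v t

/-- An opponent selector at state `s`: a distribution over available joint opponent actions. -/
structure OppSelector (s : Gm.State) where
  toFun : Gm.OppAct → ℝ
  nonneg : ∀ b, 0 ≤ toFun b
  support_av : ∀ b, ¬ Gm.OppAvailable s b → toFun b = 0
  sum_one : ∑ b, toFun b = 1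

/-- Expected value of `v` at the successor of `s` under a collective selector `ξ`
and an opponent selector `ζ`. -/
def preSel (v : Gm.State → ℝ) (s : Gm.State) (ξ : Gm.TeamSelector s) (ζ : Gm.OppSelector s) : ℝ :=
  ∑ b, ζ.toFun b * Gm.preTeamAct v s ξ b

/-- The predecessor operator: best one-step value the team can guarantee. -/
def pre (v : Gm.State → ℝ) (s : Gm.State) : ℝ :=
  ⨆ ξ : Gm.TeamSelector s, ⨅ ζ : Gm.OppSelector s, Gm.preSel v s ξ ζ

/-- The value iteration sequence: `vIter 0` is the indicator of the target set
and `vIter (n+1) = pre (vIter n)`. -/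
def vIter : ℕ → Gm.State → ℝ
  | 0 => fun s => if s ∈ Gm.target then 1 else 0
  | n + 1 => Gm.pre (vIter n)

/-- The max-min value of the game started at `s`. -/
def maxminFrom (s : Gm.State) : ℝ :=
  ⨆ σ : Gm.TeamStrategy, ⨅ τ : Gm.OppStrategy, Gm.reachProbFrom (Gm.combine σ τ) s

/-- The set of states from which the team can win almost surely. -/
def winSet : Set Gm.State :=
  {s | ∃ σ : Gm.TeamStrategy, ∀ τ : Gm.OppStrategy, Gm.reachProbFrom (Gm.combine σ τ) s = 1}

/-- Distribution of the successor of `s` when the team plays the collective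
selector `ξ` and the opponent plays the joint action `b`. -/
def succProbSel (s : Gm.State) (ξ : Gm.TeamSelector s) (b : Gm.OppAct) (t : Gm.State) : ℝ :=
  ∑ a : Gm.TeamAct, (∏ p, (ξ p).toFun (a p)) * Gm.trans s (Gm.combineAct a b) t

/-- Distribution of the successor of `s` (with history `h`) when the team plays the
collective strategy `σ` and the opponent plays the joint action `b`. -/
def succProbTeam (σ : Gm.TeamStrategy) (h : List Gm.State) (s : Gm.State)
    (b : Gm.OppAct) (t : Gm.State) : ℝ :=
  ∑ a : Gm.TeamAct, (∏ p, (σ p).toFun h s (a p)) * Gm.trans s (Gm.combineAct a b) t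

/-- The layered decomposition of the almost-sure winning set. -/
def wSeq : ℕ → Set Gm.State
  | 0 => ↑Gm.target
  | k + 1 =>
      wSeq k ∪
      {s ∈ Gm.winSet | ∃ ξ : Gm.TeamSelector s, ∀ b : Gm.OppAct, Gm.OppAvailable s b →
        (0 < ∑ t, (wSeq k).indicator (Gm.succProbSel s ξ b) t) ∧
        (∑ t, Gm.winSet.indicator (Gm.succProbSel s ξ b) t = 1)}

end Game

/-- The strategy that plays every available action with the same probability. -/
def Strategy.uniform (G : GameStructure) (p : G.Player) : Strategy G p where
  toFun _ s a := if a ∈ G.Av p s then ((G.Av p s).card : ℝ)⁻¹ else 0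
  nonneg _ s a := by split_ifs <;> positivity
  support_av _ s a ha := if_neg ha
  sum_one _ s := by
    have hc : ((G.Av p s).card : ℝ) ≠ 0 :=
      Nat.cast_ne_zero.mpr (Finset.card_ne_zero.mpr (G.av_nonempty p s))
    simp [hc]

theorem Strategy.uniform_ne_zero {G : GameStructure} {p : G.Player} {h : List G.State}
    {s : G.State} {a : G.Act p} (ha : a ∈ G.Av p s) :
    (Strategy.uniform G p).toFun h s a ≠ 0 := by
  simpa [Strategy.uniform, ha] using G.av_nonempty p s |>.ne_empty

/-- The deterministic memoryless strategy that plays `f s` at state `s`. -/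
def Strategy.pure {G : GameStructure} {p : G.Player} (f : G.State → G.Act p)
    (hf : ∀ s, f s ∈ G.Av p s) : Strategy G p where
  toFun _ s a := if a = f s then 1 else 0
  nonneg _ s a := by split_ifs <;> simp
  support_av _ s a ha := if_neg fun h : a = f s => ha (h ▸ hf s)
  sum_one _ s := by simp

theorem Strategy.exists_ne_zero {G : GameStructure} {p : G.Player} (σ : Strategy G p)
    (h : List G.State) (s : G.State) : ∃ a, σ.toFun h s a ≠ 0 := by
  by_contra! hz
  simpa [hz] using σ.sum_one h s

theorem Strategy.mem_av_of_ne_zero {G : GameStructure} {p : G.Player} (σ : Strategy G p)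
    {h : List G.State} {s : G.State} {a : G.Act p} (ha : σ.toFun h s a ≠ 0) :
    a ∈ G.Av p s := by
  by_contra hn
  exact ha (σ.support_av h s a hn)

namespace Game

variable {Gm : Game} (π : (p : Gm.Player) → Strategy Gm.toGameStructure p)

theorem combine_of_mem (σ : Gm.TeamStrategy) (τ : Gm.OppStrategy) {p : Gm.Player}
    (hp : p ∈ Gm.team) : Gm.combine σ τ p = σ ⟨p, hp⟩ := dif_pos hp

theorem combine_of_notMem (σ : Gm.TeamStrategy) (τ : Gm.OppStrategy) {p : Gm.Player}
    (hp : p ∉ Gm.team) : Gm.combine σ τ p = τ ⟨p, hp⟩ := dif_neg hp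

theorem stepProb_nonneg (h : List Gm.State) (s t : Gm.State) : 0 ≤ Gm.stepProb π h s t :=
  Finset.sum_nonneg fun a _ =>
    mul_nonneg (Finset.prod_nonneg fun p _ => (π p).nonneg h s (a p)) (Gm.trans_nonneg s a t)

theorem sum_stepProb (h : List Gm.State) (s : Gm.State) : ∑ t, Gm.stepProb π h s t = 1 := by
  unfold stepProb
  rw [Finset.sum_comm]
  simp_rw [← Finset.mul_sum, Gm.trans_sum, mul_one]
  rw [← Fintype.prod_sum fun p a => (π p).toFun h s a]
  simp [(π _).sum_one]

theorem stepProb_pos {h : List Gm.State} {s t : Gm.State} {a : (p : Gm.Player) → Gm.Act p}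
    (ha : ∀ p, (π p).toFun h s (a p) ≠ 0) (ht : Gm.trans s a t ≠ 0) :
    0 < Gm.stepProb π h s t := by
  refine lt_of_lt_of_le ?_ (Finset.single_le_sum (fun a _ => mul_nonneg
    (Finset.prod_nonneg fun p _ => (π p).nonneg h s (a p)) (Gm.trans_nonneg s a t))
    (Finset.mem_univ a))
  exact mul_pos (Finset.prod_pos fun p _ => ((π p).nonneg h s (a p)).lt_of_ne' (ha p))
    ((Gm.trans_nonneg s a t).lt_of_ne' ht)

theorem stepProb_eq_zero {h : List Gm.State} {s t : Gm.State}
    (hz : ∀ a : (p : Gm.Player) → Gm.Act p, (∀ p, (π p).toFun h s (a p) ≠ 0) →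
      Gm.trans s a t = 0) :
    Gm.stepProb π h s t = 0 := by
  refine Finset.sum_eq_zero fun a _ => ?_
  by_cases ha : ∀ p, (π p).toFun h s (a p) ≠ 0
  · rw [hz a ha, mul_zero]
  · push Not at ha
    obtain ⟨p, hp⟩ := ha
    rw [Finset.prod_eq_zero (Finset.mem_univ p) hp, zero_mul]

theorem reachWithin_nonneg (n : ℕ) (h : List Gm.State) (s : Gm.State) :
    0 ≤ Gm.reachWithin π n h s := by
  induction n generalizing h s with
  | zero => unfold reachWithin; split_ifs <;> simp
  | succ n ih =>
    unfold reachWithin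
    split_ifs
    · exact zero_le_one
    · exact Finset.sum_nonneg fun t _ => mul_nonneg (stepProb_nonneg π h s t) (ih _ t)

theorem reachWithin_le_one (n : ℕ) (h : List Gm.State) (s : Gm.State) :
    Gm.reachWithin π n h s ≤ 1 := by
  induction n generalizing h s with
  | zero => unfold reachWithin; split_ifs <;> simp
  | succ n ih =>
    unfold reachWithin
    split_ifs
    · exact le_rfl
    · rw [← sum_stepProb π h s]
      exact Finset.sum_le_sum fun t _ =>
        mul_le_of_le_one_right (stepProb_nonneg π h s t) (ih _ t)

theorem reachWithin_eq_zero_of_reachProbFrom_eq_zero {s : Gm.State}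
    (hs : Gm.reachProbFrom π s = 0) (n : ℕ) : Gm.reachWithin π n [] s = 0 := by
  refine le_antisymm ?_ (reachWithin_nonneg π n [] s)
  rw [← hs]
  exact le_ciSup (f := fun n => Gm.reachWithin π n [] s)
    ⟨1, Set.forall_mem_range.mpr fun n => reachWithin_le_one π n [] s⟩ n

/-- The states from which, after some history, the profile `π` almost surely avoids the target. -/
def safeSet : Set Gm.State :=
  {s | ∃ h, ∀ n, Gm.reachWithin π n h s = 0}

theorem notMem_target_of_reachWithin {h : List Gm.State} {s : Gm.State}
    (hs : Gm.reachWithin π 0 h s = 0) : s ∉ Gm.target := by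
  intro ht
  simp [reachWithin, ht] at hs

theorem mem_safeSet_of_trans {h : List Gm.State} {s t : Gm.State}
    (hs : ∀ n, Gm.reachWithin π n h s = 0) {a : (p : Gm.Player) → Gm.Act p}
    (ha : ∀ p, (π p).toFun h s (a p) ≠ 0) (ht : Gm.trans s a t ≠ 0) : t ∈ safeSet π := by
  refine ⟨h ++ [s], fun n => ?_⟩
  have hn := hs (n + 1)
  rw [reachWithin, if_neg (notMem_target_of_reachWithin π (hs 0)),
    Finset.sum_eq_zero_iff_of_nonneg fun t _ =>
      mul_nonneg (stepProb_nonneg π h s t) (reachWithin_nonneg π n _ t)] at hn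
  exact (mul_eq_zero.mp (hn t (Finset.mem_univ t))).resolve_left (stepProb_pos π ha ht).ne'

/-- A set of non-target states that the profile `π` never leaves is never left towards
the target. -/
theorem reachWithin_eq_zero_of_invariant {W : Set Gm.State} (hW : ∀ s ∈ W, s ∉ Gm.target)
    (hstep : ∀ s ∈ W, ∀ h, ∀ a : (p : Gm.Player) → Gm.Act p,
      (∀ p, (π p).toFun h s (a p) ≠ 0) → ∀ t, Gm.trans s a t ≠ 0 → t ∈ W)
    (n : ℕ) (h : List Gm.State) {s : Gm.State} (hs : s ∈ W) :
    Gm.reachWithin π n h s = 0 := by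
  induction n generalizing h s with
  | zero => simp [reachWithin, hW s hs]
  | succ n ih =>
    rw [reachWithin, if_neg (hW s hs)]
    refine Finset.sum_eq_zero fun t _ => ?_
    by_cases ht : t ∈ W
    · rw [ih _ ht, mul_zero]
    · rw [stepProb_eq_zero π fun a ha => ?_, zero_mul]
      by_contra hne
      exact ht (hstep s hs h a ha t hne)

/-- When the team follows `σ` against the uniform opponent, at each state of `safeSet` the team has
a joint action that keeps the play in `safeSet` whatever the opponent does. -/
theorem exists_teamAct_safe (σ : Gm.TeamStrategy) (s : Gm.State) :
    ∃ a : Gm.TeamAct, (∀ p, a p ∈ Gm.Av p.1 s) ∧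
      (s ∈ safeSet (Gm.combine σ fun p => Strategy.uniform _ p.1) →
        ∀ b : (p : Gm.Player) → Gm.Act p, (∀ p : Gm.TeamPlayer, b p.1 = a p) →
          (∀ p : Gm.OppPlayer, b p.1 ∈ Gm.Av p.1 s) → ∀ t, Gm.trans s b t ≠ 0 →
            t ∈ safeSet (Gm.combine σ fun p => Strategy.uniform _ p.1)) := by
  by_cases hs : s ∈ safeSet (Gm.combine σ fun p => Strategy.uniform _ p.1)
  · obtain ⟨h, hh⟩ := hs
    choose a ha using fun p => (σ p).exists_ne_zero h s
    refine ⟨a, fun p => (σ p).mem_av_of_ne_zero (ha p), fun _ b hteam hopp t ht =>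
      mem_safeSet_of_trans _ hh (fun p => ?_) ht⟩
    by_cases hp : p ∈ Gm.team
    · rw [combine_of_mem _ _ hp, hteam ⟨p, hp⟩]
      exact ha _
    · rw [combine_of_notMem _ _ hp]
      exact Strategy.uniform_ne_zero (hopp ⟨p, hp⟩)
  · choose a ha using fun p : Gm.TeamPlayer => Gm.av_nonempty p.1 s
    exact ⟨a, ha, fun h => absurd h hs⟩

end Game

/-- If some collective strategy ensures, against every opponent
strategy, that the target set is never visited with probability 1 (i.e. the
probability of reaching it is 0), then some deterministic memoryless collective
strategy has the same property. -/
theorem safe_almost_sure_deterministic_memoryless (Gm : Game)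
    (h : ∃ σ : Gm.TeamStrategy, ∀ τ : Gm.OppStrategy, Gm.reachProb (Gm.combine σ τ) = 0) :
    ∃ σ : Gm.TeamStrategy, Gm.MemorylessTeam σ ∧ Gm.DeterministicTeam σ ∧
      ∀ τ : Gm.OppStrategy, Gm.reachProb (Gm.combine σ τ) = 0 := by
  obtain ⟨σ, hσ⟩ := h
  choose f hf hsafe using fun s => Game.exists_teamAct_safe σ s
  refine ⟨fun p => Strategy.pure (fun s => f s p) fun s => hf s p, fun p _ _ _ => rfl,
    fun p _ s => ⟨f s p, if_pos rfl⟩, fun τ => ?_⟩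
  have hinit : Gm.init ∈ Game.safeSet (Gm.combine σ fun p => Strategy.uniform _ p.1) :=
    ⟨[], Game.reachWithin_eq_zero_of_reachProbFrom_eq_zero _ (hσ _)⟩
  have hzero := fun n => Game.reachWithin_eq_zero_of_invariant
    (Gm.combine (fun p => Strategy.pure (fun s => f s p) fun s => hf s p) τ)
    (W := Game.safeSet (Gm.combine σ fun p => Strategy.uniform _ p.1))
    (fun s ⟨_, hs⟩ => Game.notMem_target_of_reachWithin _ (hs 0))
    (fun s hs h a ha => hsafe s hs a
      (fun p => by
        have := ha p.1
        rw [Game.combine_of_mem _ _ p.2] at this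
        by_contra hne
        exact this (if_neg hne))
      (fun p => by
        have := ha p.1
        rw [Game.combine_of_notMem _ _ p.2] at this
        exact (τ p).mem_av_of_ne_zero this))
    n [] hinit
  simp [Game.reachProb, Game.reachProbFrom, hzero]
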